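/- arXiv:math/0510346 — 2 statements merged into one kernel-verified Lean document; each statement's English description precedes it below -/
import Mathlib

section
/- Let g be a finite-dimensional complex semisimple Lie algebra (i.e. its Killing form is nondegenerate) and let v ∈ g be a nilpotent element, meaning the adjoint endomorphism ad v is nilpotent. Then there exist elements H, u ∈ g such that ⁅H, v⁆ = 2•v, ⁅H, u⁆ = −2•u, and ⁅v, u⁆ = H. -/
section CharZero

variable {K V : Type*} [Field K] [CharZero K] [AddCommGroup V] [Module K V]

/-- If `C = AB - BA` commutes with `A`, then `Aⁿ⁺¹B - BAⁿ⁺¹ = (n + 1) AⁿC`. -/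
theorem pow_succ_mul_eq_of_commute_commutator {R : Type*} [Ring R] {A B C : R}
    (hC : A * B = B * A + C) (hAC : Commute A C) (n : ℕ) :
    A ^ (n + 1) * B = B * A ^ (n + 1) + (n + 1) * (A ^ n * C) := by
  induction n with
  | zero => simpa using hC
  | succ n ih =>
    have h : C * A ^ (n + 1) = A ^ (n + 1) * C := ((hAC.pow_left (n + 1)).eq).symm
    have hn : A * ((n : R) + 1) = (n + 1) * A :=
      (((Nat.cast_commute n A).symm).add_right (Commute.one_right A)).eq
    calc A ^ (n + 1 + 1) * B = A * (A ^ (n + 1) * B) := by rw [pow_succ' A (n + 1), mul_assoc]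
      _ = (A * B) * A ^ (n + 1) + A * (n + 1) * (A ^ n * C) := by rw [ih]; noncomm_ring
      _ = B * (A * A ^ (n + 1)) + C * A ^ (n + 1) + (n + 1) * (A * A ^ n * C) := by
        rw [hC, hn]; noncomm_ring
      _ = _ := by
        rw [h, ← pow_succ', ← pow_succ']; push_cast; noncomm_ring

/-- **Jacobson's lemma**: a commutator `C = AB - BA` that commutes with the nilpotent element `A`
is nilpotent. -/
theorem isNilpotent_commutator_of_commute {A B C : Module.End K V}
    (hC : A * B = B * A + C) (hAC : Commute A C) (hA : IsNilpotent A) : IsNilpotent C := by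
  obtain ⟨N, hN⟩ := hA
  suffices ∀ k m : ℕ, A ^ k * C ^ m = 0 → IsNilpotent C from this N 0 (by simp [hN])
  intro k
  induction k with
  | zero => exact fun m h => ⟨m, by simpa using h⟩
  | succ k ih =>
    intro m h
    have h' : C ^ m * A ^ (k + 1) = 0 := by rw [← (hAC.pow_pow (k + 1) m).eq, h]
    have key := congrArg (fun X => C ^ m * X * C ^ m)
      (pow_succ_mul_eq_of_commute_commutator hC hAC k)
    have hcast : ((k : Module.End K V) + 1) = algebraMap K _ ((k : K) + 1) := by simp
    have e1 : C ^ m * (A ^ (k + 1) * B) * C ^ m = 0 := by simp [← mul_assoc, h']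
    have e2 : C ^ m * (B * A ^ (k + 1)) * C ^ m = 0 := by simp [mul_assoc, h]
    have e3 : C ^ m * (A ^ k * C) * C ^ m = A ^ k * C ^ (m + 1 + m) := by
      rw [← mul_assoc (C ^ m), ← (hAC.pow_pow k m).eq]
      simp only [pow_add, pow_one, mul_assoc]
    rw [hcast, ← Algebra.smul_def] at key
    simp only [mul_add, add_mul, mul_smul_comm, smul_mul_assoc] at key
    rw [e1, e2, zero_add, e3] at key
    exact ih _ ((smul_eq_zero.mp key.symm).resolve_left (Nat.cast_add_one_ne_zero k))

/-- If `C = AB - BA` commutes with the nilpotent element `A`, then `AB` is nilpotent. -/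
theorem isNilpotent_mul_of_commute_commutator {A B C : Module.End K V}
    (hC : A * B = B * A + C) (hAC : Commute A C) (hA : IsNilpotent A) : IsNilpotent (A * B) := by
  obtain ⟨N, hN⟩ := isNilpotent_commutator_of_commute hC hAC hA
  have hker : ∀ k : ℕ, ∃ m : ℕ, ∀ x : V, (A ^ k) x = 0 → ((A * B) ^ m) x = 0 := by
    intro k
    induction k with
    | zero => exact ⟨0, fun x hx => by simpa using hx⟩
    | succ k ih =>
      obtain ⟨m, hm⟩ := ih
      have step : ∀ x : V, (A ^ (k + 1)) x = 0 → ∀ j : ℕ,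
          (A ^ (k + 1)) (((A * B) ^ j) x) = 0 ∧
          (A ^ k) (((A * B) ^ j) x) = ((k : K) + 1) ^ j • (C ^ j) ((A ^ k) x) := by
        intro x hx j
        induction j with
        | zero => simp [hx]
        | succ j ihj =>
          obtain ⟨h1, h2⟩ := ihj
          have key : (A ^ k) (((A * B) ^ (j + 1)) x)
              = ((k : K) + 1) • C ((A ^ k) (((A * B) ^ j) x)) := by
            have := LinearMap.congr_fun (pow_succ_mul_eq_of_commute_commutator hC hAC k)
              (((A * B) ^ j) x)
            rw [(hAC.pow_left k).eq] at this
            rw [pow_succ' (A * B), Module.End.mul_apply, ← Module.End.mul_apply, ← mul_assoc,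
              ← pow_succ, this]
            simp [h1, Module.End.mul_apply, add_smul, Nat.cast_smul_eq_nsmul]
          refine ⟨?_, ?_⟩
          · rw [pow_succ', Module.End.mul_apply, key, map_smul, ← Module.End.mul_apply, hAC.eq,
              Module.End.mul_apply, ← Module.End.mul_apply A, ← pow_succ', h1]
            simp
          · rw [key, h2, map_smul, smul_smul, ← pow_succ', ← Module.End.mul_apply, ← pow_succ']
      refine ⟨m + N, fun x hx => ?_⟩
      rw [pow_add, Module.End.mul_apply]
      exact hm _ (by rw [(step x hx N).2, hN]; simp)
  obtain ⟨n, hn⟩ := hA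
  obtain ⟨m, hm⟩ := hker n
  exact ⟨m, LinearMap.ext fun x => hm x (by simp [hn])⟩

/-- If `H = AZ - ZA` and `HA - AH = 2A`, then `Aⁿ⁺¹Z - ZAⁿ⁺¹ = (n + 1) (H - n) Aⁿ`. -/
theorem pow_succ_mul_eq_of_sl2_relations {R : Type*} [Ring R] {A Z H : R}
    (hZ : A * Z = Z * A + H) (hH : A * H = H * A - 2 * A) (n : ℕ) :
    A ^ (n + 1) * Z = Z * A ^ (n + 1) + (n + 1) * ((H - n) * A ^ n) := by
  induction n with
  | zero => simpa using hZ
  | succ n ih =>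
    have hn : A * (n : R) = n * A := ((Nat.cast_commute n A).symm).eq
    have hn' : A * ((n : R) + 1) = (n + 1) * A := by rw [mul_add, hn]; noncomm_ring
    calc A ^ (n + 1 + 1) * Z = A * (A ^ (n + 1) * Z) := by rw [pow_succ' A (n + 1), mul_assoc]
      _ = (A * Z) * A ^ (n + 1) + A * (n + 1) * ((H - n) * A ^ n) := by rw [ih]; noncomm_ring
      _ = Z * (A * A ^ (n + 1)) + H * A ^ (n + 1) + (n + 1) * ((A * H - A * n) * A ^ n) := by
        rw [hZ, hn']; noncomm_ring
      _ = Z * (A * A ^ (n + 1)) + H * A ^ (n + 1) + (n + 1) * ((H - 2 - n) * (A * A ^ n)) := by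
        rw [hH, hn]; noncomm_ring
      _ = _ := by
        rw [← pow_succ', ← pow_succ']; push_cast; noncomm_ring

/-- If `H = AZ - ZA`, `HA - AH = 2A` and `A` is nilpotent, then `H + 2` is injective on `ker A`. -/
theorem eq_zero_of_sl2_relations {A Z H : Module.End K V}
    (hZ : A * Z = Z * A + H) (hH : A * H = H * A - 2 * A) (hA : IsNilpotent A)
    {x : V} (hx : A x = 0) (hHx : H x = (-2 : K) • x) : x = 0 := by
  have hrange : ∀ i : ℕ, ∃ a, (A ^ i) a = x := by
    intro i
    induction i with
    | zero => exact ⟨x, by simp⟩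
    | succ i ih =>
      obtain ⟨a, ha⟩ := ih
      have ha' : (A ^ (i + 1)) a = 0 := by rw [pow_succ', Module.End.mul_apply, ha, hx]
      have key : (A ^ (i + 1)) (Z a) = (((i : K) + 1) * (-2 - i)) • x := by
        have := LinearMap.congr_fun (pow_succ_mul_eq_of_sl2_relations hZ hH i) a
        rw [← Module.End.mul_apply, this]
        simp only [LinearMap.add_apply, Module.End.mul_apply, ha', map_zero, zero_add, ha,
          LinearMap.sub_apply, hHx, Module.End.natCast_apply, Module.End.one_apply]
        module
      have hne : ((i : K) + 1) * (-2 - i) ≠ 0 := by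
        refine mul_ne_zero (Nat.cast_add_one_ne_zero i) fun h => ?_
        have h2 : ((i + 2 : ℕ) : K) = 0 := by push_cast; linear_combination -h
        exact absurd (Nat.cast_eq_zero.mp h2) (by omega)
      exact ⟨(((i : K) + 1) * (-2 - i))⁻¹ • Z a, by rw [map_smul, key, inv_smul_smul₀ hne]⟩
  obtain ⟨n, hn⟩ := hA
  obtain ⟨a, ha⟩ := hrange n
  rw [← ha, hn, LinearMap.zero_apply]

/-- If `H = AZ - ZA`, `HA - AH = 2A` and `A` is nilpotent, then `H + 2` maps `ker A` onto itself. -/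
theorem exists_add_two_smul_eq_of_sl2_relations [Module.Finite K V] {A Z H : Module.End K V}
    (hZ : A * Z = Z * A + H) (hH : A * H = H * A - 2 * A) (hA : IsNilpotent A)
    {y : V} (hy : A y = 0) : ∃ x, A x = 0 ∧ H x + (2 : K) • x = y := by
  have hmaps : ∀ x ∈ LinearMap.ker A, (H + (2 : K) • (1 : Module.End K V)) x ∈ LinearMap.ker A := by
    intro x hx
    rw [LinearMap.mem_ker] at hx ⊢
    have := LinearMap.congr_fun hH x
    simp only [Module.End.mul_apply, LinearMap.sub_apply, hx, map_zero, sub_zero] at this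
    simp [this, hx]
  have hinj : Function.Injective ((H + (2 : K) • (1 : Module.End K V)).restrict hmaps) := by
    rw [injective_iff_map_eq_zero]
    rintro ⟨x, hx⟩ h
    have h' : H x + (2 : K) • x = 0 := by simpa using congrArg Subtype.val h
    refine Subtype.ext (eq_zero_of_sl2_relations hZ hH hA hx ?_)
    rw [neg_smul]
    exact eq_neg_of_add_eq_zero_left h'
  obtain ⟨⟨x, hx⟩, hxy⟩ := LinearMap.injective_iff_surjective.mp hinj ⟨y, hy⟩
  exact ⟨x, hx, by simpa using congrArg Subtype.val hxy⟩

end CharZero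

section LieAlgebra

variable {K L : Type*} [Field K] [LieRing L] [LieAlgebra K L]

/-- `ad x * ad y = ad y * ad x + ad ⁅x, y⁆`. -/
theorem LieAlgebra.ad_mul_ad (x y : L) :
    LieAlgebra.ad K L x * LieAlgebra.ad K L y =
      LieAlgebra.ad K L y * LieAlgebra.ad K L x + LieAlgebra.ad K L ⁅x, y⁆ := by
  ext z
  simp

/-- An ad-nilpotent element `e` is Killing-orthogonal to the kernel of `(ad e)²`. -/
theorem killingForm_eq_zero_of_lie_lie_eq_zero [CharZero K] {e z : L}
    (he : IsNilpotent (LieAlgebra.ad K L e))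
    (hz : ⁅e, ⁅e, z⁆⁆ = 0) : killingForm K L e z = 0 := by
  have hcomm : Commute (LieAlgebra.ad K L e) (LieAlgebra.ad K L ⁅e, z⁆) := by
    have := LieAlgebra.ad_mul_ad (K := K) e ⁅e, z⁆
    rwa [hz, map_zero, add_zero] at this
  rw [killingForm_apply_apply]
  exact (LinearMap.isNilpotent_trace_of_isNilpotent
    (isNilpotent_mul_of_commute_commutator (LieAlgebra.ad_mul_ad e z) hcomm he)).eq_zero

/-- If the Killing form is nondegenerate, an ad-nilpotent element `e` is in the range of
`(ad e)²`. -/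
theorem exists_lie_lie_eq_of_isNilpotent_ad [CharZero K] [Module.Finite K L]
    (hL : (killingForm K L).Nondegenerate) {e : L} (he : IsNilpotent (LieAlgebra.ad K L e)) :
    ∃ y : L, ⁅e, ⁅e, y⁆⁆ = e := by
  by_contra hne
  set A := LieAlgebra.ad K L e with hA
  have hmem : e ∉ LinearMap.range (A * A) := by
    rintro ⟨y, hy⟩
    exact hne ⟨y, by simpa [hA] using hy⟩
  obtain ⟨f, hfe, hf⟩ := Submodule.exists_le_ker_of_notMem hmem
  obtain ⟨z, rfl⟩ := (LinearMap.BilinForm.toDual (killingForm K L) hL).surjective f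
  simp only [LinearMap.BilinForm.toDual_def] at hfe
  have hz : ⁅e, ⁅e, z⁆⁆ = 0 := by
    refine hL.1 _ fun y => ?_
    have hy : killingForm K L z ⁅e, ⁅e, y⁆⁆ = 0 := by
      have := hf (LinearMap.mem_range_self (A * A) y)
      simpa [LinearMap.BilinForm.toDual_def, hA] using this
    rw [← hy]
    simp only [killingForm, LieModule.traceForm_apply_lie_apply']
    simp
  exact hfe (by
    rw [killingForm, LieModule.traceForm_comm]
    exact killingForm_eq_zero_of_lie_lie_eq_zero he hz)

end LieAlgebra

/-- **Jacobson–Morozov theorem.** Let `L` be a finite-dimensional complex Lie algebra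
whose Killing form is nondegenerate (i.e. `L` is semisimple), and let `v ∈ L` be a
nilpotent element, i.e. the adjoint endomorphism `ad v` is nilpotent. Then there exist
`H, u ∈ L` with `⁅H, v⁆ = 2 • v`, `⁅H, u⁆ = -2 • u` and `⁅v, u⁆ = H`. -/
theorem jacobson_morozov (L : Type*) [LieRing L] [LieAlgebra ℂ L]
    [Module.Finite ℂ L]
    (hsemisimple : (killingForm ℂ L).Nondegenerate)
    (v : L) (hv : IsNilpotent (LieAlgebra.ad ℂ L v)) :
    ∃ H u : L, ⁅H, v⁆ = (2 : ℂ) • v ∧ ⁅H, u⁆ = (-2 : ℂ) • u ∧ ⁅v, u⁆ = H := by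
  obtain ⟨y, hy⟩ := exists_lie_lie_eq_of_isNilpotent_ad hsemisimple hv
  obtain ⟨z, h, hz, hh⟩ : ∃ z h : L, ⁅v, z⁆ = h ∧ ⁅h, v⁆ = (2 : ℂ) • v := by
    refine ⟨(-2 : ℂ) • y, _, rfl, ?_⟩
    rw [← lie_skew, lie_smul, lie_smul, hy, neg_smul, neg_neg]
  have hvh : ⁅v, h⁆ = (-2 : ℂ) • v := by rw [← lie_skew, hh, neg_smul]
  have hZ := LieAlgebra.ad_mul_ad (K := ℂ) v z
  rw [hz] at hZ
  have hH : LieAlgebra.ad ℂ L v * LieAlgebra.ad ℂ L h =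
      LieAlgebra.ad ℂ L h * LieAlgebra.ad ℂ L v - 2 * LieAlgebra.ad ℂ L v := by
    rw [LieAlgebra.ad_mul_ad, hvh, map_smul, neg_smul, ← sub_eq_add_neg, two_smul, two_mul]
  have hker : LieAlgebra.ad ℂ L v (⁅h, z⁆ + (2 : ℂ) • z) = 0 := by
    rw [LieAlgebra.ad_apply, lie_add, leibniz_lie, hvh, lie_smul, smul_lie, hz, lie_self]
    module
  obtain ⟨x, hx, hxz⟩ := exists_add_two_smul_eq_of_sl2_relations hZ hH hv hker
  rw [LieAlgebra.ad_apply] at hx hxz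
  refine ⟨h, z - x, hh, ?_, ?_⟩
  · rw [lie_sub, eq_sub_of_add_eq hxz]
    module
  · rw [lie_sub, hz, hx, sub_zero]
end

section
/- Let g be a finite-dimensional complex Lie algebra, (H, v, u) an sl₂-triple in g, and for an integer i let gᵢ = {x ∈ g : ⁅H, x⁆ = i•x}. If g₁ = 0, then gᵢ = 0 for every odd integer i. -/
/-- In a finite-dimensional representation, an eigenvector of `h` killed by `e` vanishes as soon as
its eigenvalue is a negative integer. -/
theorem IsSl2Triple.eq_zero_of_lie_h_of_lie_e {L M : Type*} [LieRing L] [LieAlgebra ℂ L]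
    [AddCommGroup M] [Module ℂ M] [LieRingModule L M] [LieModule ℂ L M] [FiniteDimensional ℂ M]
    {h e f : L} (t : IsSl2Triple h e f) {m : M} {i : ℤ} (hi : i < 0)
    (hm : ⁅h, m⁆ = (i : ℂ) • m) (he : ⁅e, m⁆ = 0) : m = 0 := by
  by_contra hne
  have P : t.HasPrimitiveVectorWith m (i : ℂ) := ⟨hne, hm, he⟩
  obtain ⟨n, hn⟩ := P.exists_nat
  have hin : i = (n : ℤ) := by exact_mod_cast hn
  lia


/-- Let `L` be a finite-dimensional complex Lie algebra, `(H, v, u)` an `sl₂`-triple in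
`L`, and for an integer `i` let `Lᵢ = {x : ⁅H, x⁆ = i • x}` be the `i`-eigenspace of
`ad H`. If `L₁ = 0`, then `Lᵢ = 0` for every odd integer `i` (the orbit is "even"). -/
theorem sl2_triple_eigenspace_one_bot_implies_odd_bot
    (L : Type*) [LieRing L] [LieAlgebra ℂ L] [FiniteDimensional ℂ L]
    (H v u : L)
    (h1 : ⁅H, v⁆ = (2 : ℂ) • v) (h2 : ⁅H, u⁆ = (-2 : ℂ) • u) (h3 : ⁅v, u⁆ = H)
    (hone : Module.End.eigenspace (LieAlgebra.ad ℂ L H) (1 : ℂ) = ⊥) :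
    ∀ i : ℤ, Odd i →
      Module.End.eigenspace (LieAlgebra.ad ℂ L H) (i : ℂ) = ⊥ := by
  intro i hi
  by_cases hH : H = 0
  · have hi0 : (i : ℂ) ≠ 0 := by
      rintro h
      rw [Int.cast_eq_zero.mp h] at hi
      exact absurd hi (by decide)
    refine (Submodule.eq_bot_iff _).2 fun x hx ↦ ?_
    rw [Module.End.mem_eigenspace_iff, LieAlgebra.ad_apply, hH, zero_lie] at hx
    exact (smul_eq_zero.mp hx.symm).resolve_left hi0
  have t : IsSl2Triple H v u :=
    ⟨hH, h3, by rw [h1, two_smul, two_nsmul], by rw [h2, neg_smul, two_smul, two_nsmul]⟩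
  have up (k : ℕ) : ∀ x : L, ⁅H, x⁆ = ((1 + 2 * k : ℤ) : ℂ) • x → x = 0 := by
    induction k with
    | zero =>
      intro x hx
      have hmem : x ∈ Module.End.eigenspace (LieAlgebra.ad ℂ L H) (1 : ℂ) := by
        simpa [Module.End.mem_eigenspace_iff] using hx
      simpa [hone] using hmem
    | succ k ih =>
      intro x hx
      refine t.symm.eq_zero_of_lie_h_of_lie_e (i := -(1 + 2 * (k + 1 : ℕ))) (by lia) ?_
        (ih _ ?_)
      · rw [neg_lie, hx, Int.cast_neg, neg_smul]
      · rw [leibniz_lie, h2, hx, smul_lie, lie_smul, ← add_smul]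
        congr 1
        push_cast
        ring
  have down (k : ℕ) : ∀ x : L, ⁅H, x⁆ = ((1 - 2 * k : ℤ) : ℂ) • x → x = 0 := by
    induction k with
    | zero => simpa using up 0
    | succ k ih =>
      intro x hx
      refine t.eq_zero_of_lie_h_of_lie_e (i := 1 - 2 * (k + 1 : ℕ)) (by lia) hx (ih _ ?_)
      rw [leibniz_lie, h1, hx, smul_lie, lie_smul, ← add_smul]
      congr 1
      push_cast
      ring
  refine (Submodule.eq_bot_iff _).2 fun x hx ↦ ?_
  rw [Module.End.mem_eigenspace_iff, LieAlgebra.ad_apply] at hx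
  obtain ⟨j, rfl⟩ := hi
  obtain ⟨k, rfl | rfl⟩ := j.eq_nat_or_neg
  · exact up k x (by rw [hx, add_comm])
  · refine down k x ?_
    rw [hx]
    congr 2
    ring
end
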